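/- For every n ≥ 0, F_{n+2}^I(x,y,q) = x^{n+2} q^{C(n+2,2)} + Σ_{j=0}^{n} x^{n−j} y q^{(n²+3n−j²+j)/2} F_j^I(x,y,q), as an identity in ℤ[x,y,q], where C(n+2,2) = (n+2)(n+1)/2 (note that n²+3n−j²+j is always even). -/

import Mathlib

open Finset MvPolynomial

open scoped Classical

/-- `σ` (a permutation of `[n]` in one-line notation `σ 0, …, σ (n-1)`) contains the
pattern `π` (given by its one-line notation as a function `Fin m → Fin m`) if some
subsequence of `σ` is order isomorphic to `π`. -/
def PermContains {n m : ℕ} (σ : Equiv.Perm (Fin n)) (π : Fin m → Fin m) : Prop :=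
  ∃ f : Fin m → Fin n, (∀ a b : Fin m, a < b → f a < f b) ∧
    ∀ a b : Fin m, σ (f a) < σ (f b) ↔ π a < π b

/-- `σ` avoids the pattern `π`. -/
def PermAvoids {n m : ℕ} (σ : Equiv.Perm (Fin n)) (π : Fin m → Fin m) : Prop :=
  ¬ PermContains σ π

/-- The value `σ i` of the one-line notation of `σ`, as a natural number (0-based). -/
def permVal {n : ℕ} (σ : Equiv.Perm (Fin n)) (i : ℕ) : ℕ :=
  if h : i < n then (σ ⟨i, h⟩ : ℕ) else 0

/-- `inv σ` : the number of inversions, i.e. pairs of positions `i < j` with `σ i > σ j`. -/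
def invStat {n : ℕ} (σ : Equiv.Perm (Fin n)) : ℕ :=
  ((Finset.range n ×ˢ Finset.range n).filter
    fun p => p.1 < p.2 ∧ permVal σ p.2 < permVal σ p.1).card

/-- `maj σ` : the sum of all (1-based) indices `i` with `σ(i) > σ(i+1)`; with 0-based
positions, a descent at positions `i, i+1` contributes `i + 1`. -/
def majStat {n : ℕ} (σ : Equiv.Perm (Fin n)) : ℕ :=
  ∑ i ∈ Finset.range (n - 1), if permVal σ (i + 1) < permVal σ i then i + 1 else 0

/-- The number of ascents of `σ`; for `σ ∈ Sₙ(123,132,213)` (a reverse layered matching)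
this equals `d σ`, the number of doubleton blocks. -/
def ascStat {n : ℕ} (σ : Equiv.Perm (Fin n)) : ℕ :=
  ((Finset.range (n - 1)).filter fun i => permVal σ i < permVal σ (i + 1)).card

/-- The number of descents of `σ`; for `σ ∈ Sₙ(231,312,321)` (a layered matching)
this equals `d σ`, the number of doubleton blocks. -/
def descStat {n : ℕ} (σ : Equiv.Perm (Fin n)) : ℕ :=
  ((Finset.range (n - 1)).filter fun i => permVal σ (i + 1) < permVal σ i).card

/-- `Sₙ(123, 132, 213)` : permutations of `[n]` avoiding `123`, `132` and `213`
(patterns written 0-based). -/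
noncomputable def S123 (n : ℕ) : Finset (Equiv.Perm (Fin n)) :=
  Finset.univ.filter fun σ =>
    PermAvoids σ ![0, 1, 2] ∧ PermAvoids σ ![0, 2, 1] ∧ PermAvoids σ ![1, 0, 2]

/-- `Sₙ(231, 312, 321)` : permutations of `[n]` avoiding `231`, `312` and `321`
(patterns written 0-based). -/
noncomputable def S231 (n : ℕ) : Finset (Equiv.Perm (Fin n)) :=
  Finset.univ.filter fun σ =>
    PermAvoids σ ![1, 2, 0] ∧ PermAvoids σ ![2, 0, 1] ∧ PermAvoids σ ![2, 1, 0]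

/-- `Fₙᴵ(x, y, q) = Σ_{σ ∈ Sₙ(123,132,213)} x^(s σ) * y^(d σ) * q^(inv σ)` in `ℤ[x,y,q]`,
where `d σ = ascStat σ` is the number of doubletons and `s σ = n - 2 * d σ` the number of
singletons; here `x = X 0`, `y = X 1`, `q = X 2`. -/
noncomputable def FI (n : ℕ) : MvPolynomial (Fin 3) ℤ :=
  ∑ σ ∈ S123 n, X 0 ^ (n - 2 * ascStat σ) * X 1 ^ ascStat σ * X 2 ^ invStat σ

/-- A permutation avoids `123`, `132` and `213` exactly when entries at distance at least two
are inverted. -/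
lemma mem_S123_iff {n : ℕ} (σ : Equiv.Perm (Fin n)) :
    σ ∈ S123 n ↔ ∀ i j : Fin n, (i : ℕ) + 2 ≤ j → σ j < σ i := by
  rw [S123, Finset.mem_filter, and_iff_right (Finset.mem_univ σ)]
  simp only [PermAvoids, PermContains]
  constructor
  · rintro ⟨h123, h132, h213⟩ i j hij
    by_contra hlt
    let k : Fin n := ⟨i + 1, by omega⟩
    have hik : i < k := by simp [k, Fin.lt_def]
    have hkj : k < j := by simp only [k, Fin.lt_def]; omega
    have hσij : σ i < σ j :=
      lt_of_le_of_ne (not_lt.1 hlt) (σ.injective.ne (hik.trans hkj).ne)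
    have hσik : σ i ≠ σ k := σ.injective.ne hik.ne
    have hσkj : σ k ≠ σ j := σ.injective.ne hkj.ne
    have hmono : ∀ a b : Fin 3, a < b → ![i, k, j] a < ![i, k, j] b := by
      intro a b hab
      fin_cases a <;> fin_cases b <;> simp_all [hik.trans hkj]
    rcases lt_or_gt_of_ne hσik with h1 | h1
    · rcases lt_or_gt_of_ne hσkj with h2 | h2
      · refine h123 ⟨![i, k, j], hmono, fun a b => ?_⟩
        fin_cases a <;> fin_cases b <;> simp [h1, h2, hσij, h1.le, h2.le, hσij.le]
      · refine h132 ⟨![i, k, j], hmono, fun a b => ?_⟩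
        fin_cases a <;> fin_cases b <;> simp [h1, h2, hσij, h1.le, h2.le, hσij.le]
    · have h2 : σ k < σ j := h1.trans hσij
      refine h213 ⟨![i, k, j], hmono, fun a b => ?_⟩
      fin_cases a <;> fin_cases b <;> simp [h1, h2, hσij, h1.le, h2.le, hσij.le]
  · intro h
    have key : ∀ π : Fin 3 → Fin 3, π 0 < π 2 →
        ¬ ∃ f : Fin 3 → Fin n, (∀ a b : Fin 3, a < b → f a < f b) ∧
          ∀ a b : Fin 3, σ (f a) < σ (f b) ↔ π a < π b := by
      rintro π hπ ⟨f, hf, hσ⟩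
      have h01 := hf 0 1 (by decide)
      have h12 := hf 1 2 (by decide)
      have := h (f 0) (f 2) (by simp only [Fin.lt_def] at h01 h12; omega)
      exact lt_asymm this ((hσ 0 2).2 hπ)
    exact ⟨key _ (by decide), key _ (by decide), key _ (by decide)⟩

/-- Prepend the new maximal value to the one-line notation of a permutation. -/
noncomputable def consMax {n : ℕ} (τ : Equiv.Perm (Fin n)) : Equiv.Perm (Fin (n + 1)) :=
  Equiv.ofBijective (Fin.cons (Fin.last n) fun i => (τ i).castSucc : Fin (n + 1) → Fin (n + 1))
    (Finite.injective_iff_bijective.1 (Fin.cons_injective_iff.2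
      ⟨fun ⟨i, hi⟩ => (Fin.castSucc_lt_last (τ i)).ne hi,
        (Fin.castSucc_injective n).comp τ.injective⟩))

@[simp] lemma consMax_zero {n : ℕ} (τ : Equiv.Perm (Fin n)) : consMax τ 0 = Fin.last n := rfl

@[simp] lemma consMax_succ {n : ℕ} (τ : Equiv.Perm (Fin n)) (i : Fin n) :
    consMax τ i.succ = (τ i).castSucc := rfl

lemma consMax_injective {n : ℕ} :
    Function.Injective (consMax : Equiv.Perm (Fin n) → Equiv.Perm (Fin (n + 1))) := by
  intro τ τ' h
  ext i
  have := congrArg Fin.val (Equiv.congr_fun h i.succ)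
  simpa using this

lemma exists_consMax_eq {n : ℕ} (σ : Equiv.Perm (Fin (n + 1))) (h : σ 0 = Fin.last n) :
    ∃ τ, consMax τ = σ := by
  have hne : ∀ i : Fin n, σ i.succ ≠ Fin.last n := fun i hi =>
    Fin.succ_ne_zero i (σ.injective (hi.trans h.symm))
  have hinj : Function.Injective fun i : Fin n => (σ i.succ).castPred (hne i) := by
    intro i j hij
    exact Fin.succ_injective n (σ.injective (Fin.castPred_inj.1 hij))
  refine ⟨Equiv.ofBijective _ (Finite.injective_iff_bijective.1 hinj), ?_⟩
  ext i
  refine Fin.cases ?_ (fun i => ?_) i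
  · simp [h]
  · simp

/-- Prepend the two new maximal values, in increasing order, to the one-line notation of a
permutation. -/
noncomputable def consPair {n : ℕ} (τ : Equiv.Perm (Fin n)) : Equiv.Perm (Fin (n + 2)) :=
  consMax (consMax τ) * Equiv.swap 0 1

lemma consPair_injective {n : ℕ} :
    Function.Injective (consPair : Equiv.Perm (Fin n) → Equiv.Perm (Fin (n + 2))) := by
  intro τ τ' h
  exact consMax_injective (consMax_injective (mul_right_cancel h))

@[simp] lemma consPair_zero {n : ℕ} (τ : Equiv.Perm (Fin n)) :
    consPair τ 0 = (Fin.last n).castSucc := by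
  rw [consPair, Equiv.Perm.mul_apply, Equiv.swap_apply_left, ← Fin.succ_zero_eq_one,
    consMax_succ, consMax_zero]

@[simp] lemma consPair_one {n : ℕ} (τ : Equiv.Perm (Fin n)) :
    consPair τ 1 = Fin.last (n + 1) := by
  rw [consPair, Equiv.Perm.mul_apply, Equiv.swap_apply_right, consMax_zero]

@[simp] lemma consPair_succ_succ {n : ℕ} (τ : Equiv.Perm (Fin n)) (i : Fin n) :
    consPair τ i.succ.succ = (τ i).castSucc.castSucc := by
  rw [consPair, Equiv.Perm.mul_apply, Equiv.swap_apply_of_ne_of_ne, consMax_succ, consMax_succ]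
  · exact Fin.succ_ne_zero _
  · rw [← Fin.succ_zero_eq_one]
    exact fun h => Fin.succ_ne_zero i (Fin.succ_injective _ h)

lemma consMax_mem_S123 {n : ℕ} {τ : Equiv.Perm (Fin n)} :
    consMax τ ∈ S123 (n + 1) ↔ τ ∈ S123 n := by
  rw [mem_S123_iff, mem_S123_iff]
  constructor
  · intro h i j hij
    simpa using h i.succ j.succ (by simp only [Fin.val_succ]; omega)
  · intro h i j
    refine Fin.cases ?_ (fun j => ?_) j
    · intro hij; simp at hij
    · refine Fin.cases ?_ (fun i => ?_) i
      · intro _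
        simp
      · intro hij
        simpa using h i j (by simp only [Fin.val_succ] at hij; omega)

lemma consPair_mem_S123 {n : ℕ} {τ : Equiv.Perm (Fin n)} :
    consPair τ ∈ S123 (n + 2) ↔ τ ∈ S123 n := by
  rw [mem_S123_iff, mem_S123_iff]
  constructor
  · intro h i j hij
    simpa using h i.succ.succ j.succ.succ (by simp only [Fin.val_succ]; omega)
  · intro h i j
    refine Fin.cases ?_ (fun j => ?_) j
    · intro hij; simp at hij
    refine Fin.cases ?_ (fun j => ?_) j
    · intro hij; simp at hij
    refine Fin.cases ?_ (fun i => ?_) i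
    · intro _
      rw [consPair_zero, consPair_succ_succ]
      simp only [Fin.lt_def, Fin.val_castSucc, Fin.val_last]
      exact (τ j).isLt
    refine Fin.cases ?_ (fun i => ?_) i
    · intro _
      rw [Fin.succ_zero_eq_one, consPair_one, consPair_succ_succ]
      exact Fin.castSucc_lt_last _
    · intro hij
      simpa using h i j (by simp only [Fin.val_succ] at hij; omega)

/-- A reverse layered matching starts with a singleton or with a doubleton. -/
lemma exists_cons_of_mem_S123 {n : ℕ} {σ : Equiv.Perm (Fin (n + 2))} (hσ : σ ∈ S123 (n + 2)) :
    (∃ τ ∈ S123 (n + 1), consMax τ = σ) ∨ ∃ τ ∈ S123 n, consPair τ = σ := by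
  have h := (mem_S123_iff σ).1 hσ
  obtain ⟨p, hp⟩ := σ.surjective (Fin.last (n + 1))
  have hp2 : (p : ℕ) < 2 := by
    by_contra hp2
    have := h 0 p (by simp only [Fin.val_zero]; omega)
    rw [hp] at this
    exact absurd (Fin.le_last _) (not_le.2 this)
  by_cases hp0 : p = 0
  · subst hp0
    obtain ⟨τ, rfl⟩ := exists_consMax_eq σ hp
    exact Or.inl ⟨τ, consMax_mem_S123.1 hσ, rfl⟩
  have hp1 : p = 1 := by
    apply Fin.ext
    have : (p : ℕ) ≠ 0 := fun h => hp0 (Fin.ext h)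
    rw [Fin.val_one]
    omega
  subst hp1
  obtain ⟨τ, hτ⟩ := exists_consMax_eq (σ * Equiv.swap 0 1) (by simpa using hp)
  have hστ : σ = consMax τ * Equiv.swap 0 1 := by rw [hτ, mul_assoc, Equiv.swap_mul_self, mul_one]
  have hτ0 : τ 0 = Fin.last n := by
    obtain ⟨r, hr⟩ := τ.surjective (Fin.last n)
    by_contra hne
    have hr0 : r ≠ 0 := fun h => hne (h ▸ hr)
    obtain ⟨s, rfl⟩ := Fin.exists_succ_eq.2 hr0
    have hlt := h 0 s.succ.succ (by simp)
    have h0 : σ 0 = (τ 0).castSucc := by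
      rw [hστ, Equiv.Perm.mul_apply, Equiv.swap_apply_left, ← Fin.succ_zero_eq_one, consMax_succ]
    have hs : σ s.succ.succ = (τ s.succ).castSucc := by
      rw [hστ, Equiv.Perm.mul_apply, Equiv.swap_apply_of_ne_of_ne, consMax_succ]
      · exact Fin.succ_ne_zero _
      · rw [← Fin.succ_zero_eq_one]
        exact fun h => Fin.succ_ne_zero s (Fin.succ_injective _ h)
    rw [h0, hs, hr, Fin.castSucc_lt_castSucc_iff] at hlt
    exact absurd (Fin.le_last _) (not_le.2 hlt)
  obtain ⟨ρ, rfl⟩ := exists_consMax_eq τ hτ0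
  have hσρ : consPair ρ = σ := hστ.symm
  exact Or.inr ⟨ρ, consPair_mem_S123.1 (hσρ ▸ hσ), hσρ⟩

lemma permVal_of_lt {n : ℕ} (σ : Equiv.Perm (Fin n)) {i : ℕ} (h : i < n) :
    permVal σ i = σ ⟨i, h⟩ := dif_pos h

lemma permVal_lt {n : ℕ} (σ : Equiv.Perm (Fin n)) {i : ℕ} (h : i < n) : permVal σ i < n := by
  rw [permVal_of_lt σ h]
  exact Fin.isLt _

lemma permVal_consMax_zero {n : ℕ} (τ : Equiv.Perm (Fin n)) : permVal (consMax τ) 0 = n := by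
  rw [permVal_of_lt _ n.succ_pos]
  exact congrArg Fin.val (consMax_zero τ)

lemma permVal_consMax_succ {n : ℕ} (τ : Equiv.Perm (Fin n)) (i : ℕ) :
    permVal (consMax τ) (i + 1) = permVal τ i := by
  by_cases h : i < n
  · rw [permVal_of_lt _ h, permVal_of_lt _ (Nat.succ_lt_succ h)]
    exact congrArg Fin.val (consMax_succ τ ⟨i, h⟩)
  · simp [permVal, h]

lemma permVal_consPair_zero {n : ℕ} (τ : Equiv.Perm (Fin n)) : permVal (consPair τ) 0 = n := by
  rw [permVal_of_lt _ (n + 1).succ_pos]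
  exact congrArg Fin.val (consPair_zero τ)

lemma permVal_consPair_one {n : ℕ} (τ : Equiv.Perm (Fin n)) :
    permVal (consPair τ) 1 = n + 1 := by
  rw [permVal_of_lt _ (by omega)]
  exact congrArg Fin.val (consPair_one τ)

lemma permVal_consPair_add_two {n : ℕ} (τ : Equiv.Perm (Fin n)) (i : ℕ) :
    permVal (consPair τ) (i + 2) = permVal τ i := by
  by_cases h : i < n
  · rw [permVal_of_lt _ h, permVal_of_lt _ (by omega)]
    exact congrArg Fin.val (consPair_succ_succ τ ⟨i, h⟩)
  · simp [permVal, h]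

lemma ascStat_eq_sum {n : ℕ} (σ : Equiv.Perm (Fin n)) :
    ascStat σ = ∑ i ∈ Finset.range (n - 1), if permVal σ i < permVal σ (i + 1) then 1 else 0 :=
  Finset.card_filter _ _

lemma invStat_eq_sum {n : ℕ} (σ : Equiv.Perm (Fin n)) :
    invStat σ = ∑ i ∈ Finset.range n, ∑ j ∈ Finset.range n,
      if i < j ∧ permVal σ j < permVal σ i then 1 else 0 := by
  rw [invStat, Finset.card_filter, Finset.sum_product]

lemma ascStat_consMax {n : ℕ} (τ : Equiv.Perm (Fin (n + 1))) :
    ascStat (consMax τ) = ascStat τ := by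
  have h := permVal_lt τ n.succ_pos
  simp only [ascStat_eq_sum, Nat.add_sub_cancel]
  rw [Finset.sum_range_succ']
  simp only [permVal_consMax_succ, permVal_consMax_zero]
  rw [if_neg (by omega), add_zero]

lemma ascStat_consPair {n : ℕ} (τ : Equiv.Perm (Fin n)) :
    ascStat (consPair τ) = ascStat τ + 1 := by
  have e : n + 2 - 1 = n + 1 := rfl
  rw [ascStat_eq_sum, ascStat_eq_sum, e, Finset.sum_range_succ']
  simp only [zero_add, permVal_consPair_zero, permVal_consPair_one, Nat.lt_succ_self, if_true]
  congr 1
  cases n with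
  | zero => simp
  | succ n =>
    have h := permVal_lt τ n.succ_pos
    rw [Finset.sum_range_succ']
    simp only [add_assoc, Nat.reduceAdd, zero_add, permVal_consPair_one]
    rw [show permVal (consPair τ) 2 = permVal τ 0 from permVal_consPair_add_two τ 0,
      if_neg (by omega), add_zero]
    refine Finset.sum_congr (by simp) fun i _ => ?_
    rw [show i + 3 = (i + 1) + 2 from rfl, permVal_consPair_add_two,
      permVal_consPair_add_two]

lemma invStat_consMax {n : ℕ} (τ : Equiv.Perm (Fin n)) :
    invStat (consMax τ) = invStat τ + n := by
  rw [invStat_eq_sum, invStat_eq_sum, Finset.sum_range_succ']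
  congr 1
  · refine Finset.sum_congr rfl fun i _ => ?_
    rw [Finset.sum_range_succ']
    simp [permVal_consMax_succ]
  · rw [Finset.sum_range_succ', Finset.sum_congr rfl (g := fun _ => 1)]
    · simp
    · intro j hj
      have := permVal_lt τ (Finset.mem_range.1 hj)
      simp [permVal_consMax_succ, permVal_consMax_zero, this]

lemma invStat_consPair {n : ℕ} (τ : Equiv.Perm (Fin n)) :
    invStat (consPair τ) = invStat τ + 2 * n := by
  rw [invStat_eq_sum, invStat_eq_sum, Finset.sum_range_succ', Finset.sum_range_succ', add_assoc,
    two_mul]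
  congr 1
  · refine Finset.sum_congr rfl fun i _ => ?_
    rw [Finset.sum_range_succ', Finset.sum_range_succ']
    simp [add_assoc, permVal_consPair_add_two]
  · congr 1
    · rw [Finset.sum_range_succ', Finset.sum_range_succ', Finset.sum_congr rfl (g := fun _ => 1)]
      · simp
      · intro j hj
        have := permVal_lt τ (Finset.mem_range.1 hj)
        rw [if_pos]
        rw [zero_add, add_assoc, permVal_consPair_add_two, permVal_consPair_one]
        omega
    · rw [Finset.sum_range_succ', Finset.sum_range_succ', Finset.sum_congr rfl (g := fun _ => 1)]
      · simp [permVal_consPair_zero, permVal_consPair_one]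
      · intro j hj
        have := permVal_lt τ (Finset.mem_range.1 hj)
        rw [if_pos]
        rw [add_assoc, permVal_consPair_add_two, permVal_consPair_zero]
        omega

lemma two_mul_ascStat_le {n : ℕ} {σ : Equiv.Perm (Fin n)} (hσ : σ ∈ S123 n) :
    2 * ascStat σ ≤ n := by
  induction n using Nat.strong_induction_on with
  | _ n ih =>
    match n, σ, hσ, ih with
    | 0, σ, _, _ => simp [ascStat]
    | 1, σ, _, _ => simp [ascStat]
    | n + 2, σ, hσ, ih =>
      rcases exists_cons_of_mem_S123 hσ with ⟨τ, hτ, rfl⟩ | ⟨τ, hτ, rfl⟩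
      · have := ih (n + 1) (by omega) hτ
        rw [ascStat_consMax]
        omega
      · have := ih n (by omega) hτ
        rw [ascStat_consPair]
        omega

lemma S123_add_two (n : ℕ) :
    S123 (n + 2) = (S123 (n + 1)).image consMax ∪ (S123 n).image consPair := by
  ext σ
  simp only [Finset.mem_union, Finset.mem_image]
  constructor
  · exact exists_cons_of_mem_S123
  · rintro (⟨τ, hτ, rfl⟩ | ⟨τ, hτ, rfl⟩)
    · exact consMax_mem_S123.2 hτ
    · exact consPair_mem_S123.2 hτ

lemma disjoint_image_consMax_image_consPair (n : ℕ) :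
    Disjoint ((S123 (n + 1)).image consMax) ((S123 n).image consPair) := by
  rw [Finset.disjoint_left]
  intro σ h h'
  obtain ⟨τ, -, rfl⟩ := Finset.mem_image.1 h
  obtain ⟨ρ, -, hρ⟩ := Finset.mem_image.1 h'
  have := congrArg (fun σ => permVal σ 0) hρ
  simp [permVal_consMax_zero, permVal_consPair_zero] at this

/-- The three-term recurrence obtained by removing the first block. -/
lemma FI_add_two (n : ℕ) :
    FI (n + 2) = X 0 * X 2 ^ (n + 1) * FI (n + 1) + X 1 * X 2 ^ (2 * n) * FI n := by
  rw [FI, S123_add_two, Finset.sum_union (disjoint_image_consMax_image_consPair n),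
    Finset.sum_image consMax_injective.injOn, Finset.sum_image consPair_injective.injOn,
    FI, FI, Finset.mul_sum, Finset.mul_sum]
  refine congrArg₂ _ ?_ ?_
  · refine Finset.sum_congr rfl fun τ hτ => ?_
    have h := two_mul_ascStat_le hτ
    rw [ascStat_consMax, invStat_consMax,
      show n + 2 - 2 * ascStat τ = (n + 1 - 2 * ascStat τ) + 1 by omega]
    ring
  · refine Finset.sum_congr rfl fun τ _ => ?_
    rw [ascStat_consPair, invStat_consPair,
      show n + 2 - 2 * (ascStat τ + 1) = n - 2 * ascStat τ by omega]
    ring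

lemma FI_one : FI 1 = X 0 * FI 0 := by
  have h0 : S123 0 = Finset.univ :=
    Finset.eq_univ_of_forall fun σ => (mem_S123_iff σ).2 fun i => i.elim0
  have h1 : S123 1 = Finset.univ :=
    Finset.eq_univ_of_forall fun σ => (mem_S123_iff σ).2 fun i j h => by omega
  have hc : ∀ τ : Equiv.Perm (Fin 1), invStat τ = 0 := by
    intro τ
    simp [invStat_eq_sum]
  simp [FI, h0, h1, ascStat, hc, invStat_eq_sum]

lemma FI_zero : FI 0 = 1 := by
  have h0 : S123 0 = Finset.univ :=
    Finset.eq_univ_of_forall fun σ => (mem_S123_iff σ).2 fun i => i.elim0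
  simp [FI, h0, ascStat, invStat_eq_sum]

lemma exponent_succ {n j : ℕ} (h : j ≤ n) :
    ((n + 1) ^ 2 + 3 * (n + 1) - j ^ 2 + j) / 2 =
      (n ^ 2 + 3 * n - j ^ 2 + j) / 2 + (n + 2) := by
  have hj : j ^ 2 ≤ n ^ 2 := Nat.pow_le_pow_left h 2
  have e : (n + 1) ^ 2 = n ^ 2 + 2 * n + 1 := by ring
  omega

/-- `F_{n+2}ᴵ = x^(n+2) q^C(n+2,2) + Σ_{j=0}^{n} x^(n-j) y q^((n²+3n-j²+j)/2) Fⱼᴵ`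
in `ℤ[x,y,q]`. -/
theorem stmt14 (n : ℕ) :
    FI (n + 2) = X 0 ^ (n + 2) * X 2 ^ ((n + 2).choose 2) +
      ∑ j ∈ Finset.range (n + 1),
        X 0 ^ (n - j) * X 1 * X 2 ^ ((n ^ 2 + 3 * n - j ^ 2 + j) / 2) * FI j := by
  induction n with
  | zero =>
    rw [FI_add_two, zero_add, FI_one]
    simp [FI_zero]
    ring
  | succ n ih =>
    have hc : (n + 1 + 2).choose 2 = (n + 2).choose 2 + (n + 2) := by
      rw [Nat.choose_succ_succ' (n + 2) 1, Nat.choose_one_right, add_comm]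
    have he : ((n + 1) ^ 2 + 3 * (n + 1) - (n + 1) ^ 2 + (n + 1)) / 2 = 2 * (n + 1) := by omega
    rw [FI_add_two, show n + 1 + 1 = n + 2 from rfl, ih, Finset.sum_range_succ _ (n + 1), he, hc,
      mul_add, Finset.mul_sum, add_assoc]
    refine congrArg₂ _ ?_ (congrArg₂ _ ?_ ?_)
    · ring
    · refine Finset.sum_congr rfl fun j hj => ?_
      have hjn : j ≤ n := Nat.lt_succ_iff.1 (Finset.mem_range.1 hj)
      rw [exponent_succ hjn, Nat.sub_add_comm hjn]
      ring
    · simp
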